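/- arXiv:2309.05352 — 4 statements merged into one kernel-verified Lean document; each statement's English description precedes it below -/
import Mathlib

section
/- Let n ≥ 1 and let γ : ℝ → ℝ^{n+1} be defined by γ(t) = (1, t, t², …, tⁿ). A continuous function f : [0,1]ⁿ → ℝ is invariant under all permutations of its n coordinates (i.e., f(x ∘ σ) = f(x) for every permutation σ of {1,…,n} and every x ∈ [0,1]ⁿ) if and only if there exists a continuous function ρ : ℝ^{n+1} → ℝ such that f(x) = ρ(∑_{i=1}^{n} γ(x_i)) for all x ∈ [0,1]ⁿ. -/
open MvPolynomial in
/-- Over a field of characteristic zero, the first `n` power sums determine the `k`-th elementary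
symmetric polynomial for `k ≤ n`. -/
theorem aeval_esymm_eq_of_aeval_psum_eq {σ K : Type*} [Fintype σ] [Field K] [CharZero K]
    {x y : σ → K} {n : ℕ} (h : ∀ j ≤ n, aeval x (psum σ K j) = aeval y (psum σ K j))
    (k : ℕ) (hk : k ≤ n) : aeval x (esymm σ K k) = aeval y (esymm σ K k) := by
  induction k using Nat.strong_induction_on with
  | _ k ih =>
    rcases k.eq_zero_or_pos with rfl | hk0
    · simp
    have newton (z : σ → K) := congrArg (aeval z) (mul_esymm_eq_sum σ K k)
    simp only [map_mul, map_natCast, map_pow, map_neg, map_one, map_sum] at newton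
    refine mul_left_cancel₀ (Nat.cast_ne_zero.mpr hk0.ne' : (k : K) ≠ 0) ?_
    rw [newton x, newton y]
    congr 1
    refine Finset.sum_congr rfl fun a ha => ?_
    obtain ⟨ha, hlt⟩ := Finset.mem_filter.mp ha
    have hsum : a.1 + a.2 = k := Finset.HasAntidiagonal.mem_antidiagonal.mp ha
    rw [ih a.1 hlt (by lia), h a.2 (by lia)]

/-- Tuples with the same multiset of values differ by a permutation of the indices. -/
theorem exists_perm_comp_eq_of_map_univ_eq {α : Type*} [LinearOrder α] {n : ℕ} {x y : Fin n → α}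
    (h : Finset.univ.val.map x = Finset.univ.val.map y) : ∃ σ : Equiv.Perm (Fin n), x ∘ σ = y := by
  have hp : (List.ofFn x).Perm (List.ofFn y) := by simpa using h
  have hs : x ∘ Tuple.sort x = y ∘ Tuple.sort y :=
    List.ofFn_injective <|
      (((Equiv.Perm.ofFn_comp_perm _ x).trans hp).trans
        (Equiv.Perm.ofFn_comp_perm _ y).symm).eq_of_pairwise'
        (Tuple.monotone_sort x).sortedLE_ofFn.pairwise
        (Tuple.monotone_sort y).sortedLE_ofFn.pairwise
  refine ⟨(Tuple.sort y).symm.trans (Tuple.sort x), funext fun i => ?_⟩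
  simpa using congrFun hs ((Tuple.sort y).symm i)

/-- Two `n`-tuples with the same first `n` power sums differ by a permutation. -/
theorem exists_perm_comp_eq_of_sum_pow_eq {K : Type*} [Field K] [CharZero K] [LinearOrder K]
    {n : ℕ} {x y : Fin n → K} (h : ∀ j ≤ n, ∑ i, x i ^ j = ∑ i, y i ^ j) :
    ∃ σ : Equiv.Perm (Fin n), x ∘ σ = y := by
  apply exists_perm_comp_eq_of_map_univ_eq
  have hesymm (k : ℕ) (hk : k ≤ n) :
      (Finset.univ.val.map x).esymm k = (Finset.univ.val.map y).esymm k := by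
    simpa only [MvPolynomial.aeval_esymm_eq_multiset_esymm] using
      aeval_esymm_eq_of_aeval_psum_eq (n := n) (by simpa [MvPolynomial.psum] using h) k hk
  have hprod : ((Finset.univ.val.map x).map fun t => Polynomial.X - Polynomial.C t).prod =
      ((Finset.univ.val.map y).map fun t => Polynomial.X - Polynomial.C t).prod := by
    simp only [Multiset.prod_X_sub_X_eq_sum_esymm]
    refine Finset.sum_congr (by simp) fun j hj => ?_
    rw [hesymm j (by simpa [Nat.lt_succ_iff] using hj)]
    simp
  simpa only [Polynomial.roots_multiset_prod_X_sub_C] using congrArg Polynomial.roots hprod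

/-- A continuous real function on a compact set that is constant on the fibres of a continuous map
into a normal Hausdorff space factors through a continuous function on that whole space. -/
theorem IsCompact.exists_continuous_comp_eq {X Y : Type*} [TopologicalSpace X]
    [TopologicalSpace Y] [T2Space Y] [NormalSpace Y] {s : Set X} (hs : IsCompact s)
    {f : X → ℝ} {g : X → Y} (hf : ContinuousOn f s) (hg : ContinuousOn g s)
    (hfg : ∀ x ∈ s, ∀ y ∈ s, g x = g y → f x = f y) :
    ∃ ρ : Y → ℝ, Continuous ρ ∧ ∀ x ∈ s, f x = ρ (g x) := by
  have : CompactSpace s := isCompact_iff_compactSpace.mp hs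
  have hgc : Continuous (s.domRestrict g) := hg.domRestrict
  let q : C(s, Set.range (s.domRestrict g)) :=
    ⟨Set.rangeFactorization (s.domRestrict g), hgc.subtype_mk _⟩
  have hq : Topology.IsQuotientMap q :=
    Topology.IsQuotientMap.of_surjective_continuous Set.rangeFactorization_surjective q.continuous
  let F : C(s, ℝ) := ⟨s.domRestrict f, hf.domRestrict⟩
  have hF : Function.FactorsThrough F q := fun a b hab =>
    hfg a a.2 b b.2 (congrArg Subtype.val hab)
  obtain ⟨ρ, hρ⟩ := (hq.lift F hF).exists_restrict_eq (isCompact_range hgc).isClosed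
  refine ⟨ρ, ρ.continuous, fun x hx => ?_⟩
  have hlift := DFunLike.congr_fun (hq.lift_comp F hF) ⟨x, hx⟩
  have hext := DFunLike.congr_fun hρ (q ⟨x, hx⟩)
  exact hlift.symm.trans hext.symm

/-- **Deep Sets (Zaheer et al.)**: a continuous function `f : [0,1]ⁿ → ℝ` is
permutation-invariant iff it can be written as `ρ (∑ i γ(x i))` with `ρ` continuous,
where `γ t = (1, t, t², …, tⁿ)`. -/
theorem statement0 (n : ℕ) (hn : 1 ≤ n) (f : (Fin n → ℝ) → ℝ)
    (hf : ContinuousOn f (Set.Icc (0 : Fin n → ℝ) 1)) :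
    (∀ σ : Equiv.Perm (Fin n), ∀ x ∈ Set.Icc (0 : Fin n → ℝ) 1,
        f (fun i => x (σ i)) = f x) ↔
      ∃ ρ : (Fin (n + 1) → ℝ) → ℝ, Continuous ρ ∧
        ∀ x ∈ Set.Icc (0 : Fin n → ℝ) 1,
          f x = ρ (∑ i : Fin n, fun j : Fin (n + 1) => x i ^ (j : ℕ)) := by
  constructor
  · intro hinv
    refine isCompact_Icc.exists_continuous_comp_eq hf
      (Continuous.continuousOn (by fun_prop)) fun x hx y _ hxy => ?_
    obtain ⟨σ, rfl⟩ := exists_perm_comp_eq_of_sum_pow_eq (x := x) (y := y) fun j hj => by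
      simpa using congrFun hxy ⟨j, Nat.lt_succ_of_le hj⟩
    exact (hinv σ x hx).symm
  · rintro ⟨ρ, -, hρ⟩ σ x hx
    rw [hρ x hx, hρ _ ⟨fun i => hx.1 (σ i), fun i => hx.2 (σ i)⟩]
    exact congrArg ρ (Equiv.sum_comp σ fun i => fun j : Fin (n + 1) => x i ^ (j : ℕ))
end

section
/- Let n ≥ 1, 1 ≤ k ≤ n, and let γ(t) = (1, t, t², …, tⁿ) ∈ ℝ^{n+1}. A continuous function f : [0,1]ⁿ → ℝ is invariant under all permutations of its first k coordinates (f(x ∘ σ) = f(x) whenever σ is a permutation of {1,…,n} fixing every index i > k) if and only if there exists a continuous function ρ : ℝ^{n+1} × ℝ^{n-k} → ℝ such that f(x) = ρ(∑_{i=1}^{k} γ(x_i), x_{k+1}, …, x_n) for all x ∈ [0,1]ⁿ. -/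
/-- Two families with the same multiset of values differ by a permutation of the indices. -/
theorem exists_perm_of_map_univ_eq {ι α : Type*} [Fintype ι] {a b : ι → α}
    (h : Finset.univ.val.map a = Finset.univ.val.map b) :
    ∃ τ : Equiv.Perm ι, ∀ i, b (τ i) = a i := by
  classical
  have hfiber (c : α) : Nonempty ({i // a i = c} ≃ {i // b i = c}) := by
    refine ⟨Fintype.equivOfCardEq ?_⟩
    have hc := congrArg (Multiset.count c) h
    simp only [Multiset.count_map] at hc
    simpa [Fintype.card_subtype, Finset.card_def, eq_comm] using hc
  exact ⟨Equiv.ofFiberEquiv fun c => (hfiber c).some, fun i => Equiv.ofFiberEquiv_map _ i⟩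

/-- In characteristic zero, the power sums up to degree `m` determine the elementary symmetric
polynomials up to degree `m`. -/
theorem aeval_esymm_eq_of_sum_pow_eq {ι R : Type*} [Fintype ι] [CommRing R] [IsDomain R]
    [CharZero R] {a b : ι → R} {m : ℕ} (h : ∀ j ≤ m, ∑ i, a i ^ j = ∑ i, b i ^ j) :
    ∀ j ≤ m, MvPolynomial.aeval a (MvPolynomial.esymm ι R j) =
      MvPolynomial.aeval b (MvPolynomial.esymm ι R j) := by
  intro j
  induction j using Nat.strong_induction_on with
  | _ j ih =>
    intro hj
    rcases Nat.eq_zero_or_pos j with rfl | hpos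
    · simp
    have newton (c : ι → R) :=
      congrArg (MvPolynomial.aeval (R := R) c) (MvPolynomial.mul_esymm_eq_sum ι R j)
    simp only [map_mul, map_sum, map_pow, map_neg, map_one, map_natCast, MvPolynomial.psum,
      MvPolynomial.aeval_X] at newton
    refine mul_left_cancel₀ (Nat.cast_ne_zero.mpr hpos.ne') ((newton a).trans ?_)
    rw [newton b]
    congr 1
    refine Finset.sum_congr rfl fun p hp => ?_
    obtain ⟨hp, hlt⟩ := Finset.mem_filter.mp hp
    have hadd := Finset.HasAntidiagonal.mem_antidiagonal.mp hp
    rw [ih p.1 hlt (by omega), h p.2 (by omega)]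

/-- In characteristic zero, the power sums of a finite family determine the family up to a
permutation. -/
theorem exists_perm_of_sum_pow_eq {ι R : Type*} [Fintype ι] [CommRing R] [IsDomain R]
    [CharZero R] {a b : ι → R} (h : ∀ j ≤ Fintype.card ι, ∑ i, a i ^ j = ∑ i, b i ^ j) :
    ∃ τ : Equiv.Perm ι, ∀ i, b (τ i) = a i := by
  refine exists_perm_of_map_univ_eq ?_
  rw [← Polynomial.roots_multiset_prod_X_sub_C (Finset.univ.val.map a),
    ← Polynomial.roots_multiset_prod_X_sub_C (Finset.univ.val.map b),
    Multiset.prod_X_sub_X_eq_sum_esymm, Multiset.prod_X_sub_X_eq_sum_esymm]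
  simp only [Multiset.card_map]
  congr 1
  refine Finset.sum_congr rfl fun j hj => ?_
  have hj' : j ≤ Fintype.card ι := Nat.lt_succ_iff.mp (Finset.mem_range.mp hj)
  rw [← MvPolynomial.aeval_esymm_eq_multiset_esymm ι R,
    ← MvPolynomial.aeval_esymm_eq_multiset_esymm ι R, aeval_esymm_eq_of_sum_pow_eq h j hj']

/-- A continuous real function on a compact set which is constant on the fibres of a continuous
map `g` factors through `g` by a continuous function on the whole target. -/
theorem exists_continuous_factor_of_isCompact {X Y : Type*} [TopologicalSpace X]
    [TopologicalSpace Y] [T2Space Y] [NormalSpace Y] {K : Set X} (hK : IsCompact K)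
    {f : X → ℝ} (hf : ContinuousOn f K) {g : X → Y} (hg : ContinuousOn g K)
    (h : ∀ x ∈ K, ∀ y ∈ K, g x = g y → f x = f y) :
    ∃ ρ : Y → ℝ, Continuous ρ ∧ ∀ x ∈ K, f x = ρ (g x) := by
  have : CompactSpace K := isCompact_iff_compactSpace.mp hK
  have hgK : Continuous (K.domRestrict g) := continuousOn_iff_continuous_domRestrict.mp hg
  have hquot : Topology.IsQuotientMap (Set.rangeFactorization (K.domRestrict g)) :=
    (hgK.rangeFactorization.isClosedMap).isQuotientMap hgK.rangeFactorization
      Set.rangeFactorization_surjective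
  let F : C(K, ℝ) := ⟨K.domRestrict f, continuousOn_iff_continuous_domRestrict.mp hf⟩
  have hF : Function.FactorsThrough F
      (⟨Set.rangeFactorization (K.domRestrict g), hgK.rangeFactorization⟩ :
        C(K, Set.range (K.domRestrict g))) :=
    fun x y hxy => h x x.2 y y.2 (congrArg Subtype.val hxy)
  obtain ⟨ρ, hρ⟩ := ContinuousMap.exists_restrict_eq (isCompact_range hgK).isClosed
    (Topology.IsQuotientMap.lift hquot F hF)
  refine ⟨ρ, ρ.continuous, fun x hx => ?_⟩
  have h₁ := DFunLike.congr_fun (Topology.IsQuotientMap.lift_comp hquot F hF) ⟨x, hx⟩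
  have h₂ := DFunLike.congr_fun hρ (Set.rangeFactorization (K.domRestrict g) ⟨x, hx⟩)
  exact h₁.symm.trans h₂.symm

/-- A sum over the first `k` indices is invariant under permutations fixing the other indices. -/
theorem sum_castLE_perm {M : Type*} [AddCommMonoid M] {n k : ℕ} (hkn : k ≤ n)
    {σ : Equiv.Perm (Fin n)} (hσ : ∀ i : Fin n, k ≤ (i : ℕ) → σ i = i) (g : Fin n → M) :
    ∑ i : Fin k, g (σ (Fin.castLE hkn i)) = ∑ i : Fin k, g (Fin.castLE hkn i) := by
  have hsum (u : Fin n → M) :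
      ∑ i : Fin k, u (Fin.castLE hkn i) =
        ∑ i ∈ Finset.univ.filter (fun i : Fin n => (i : ℕ) < k), u i := by
    refine Finset.sum_bij (fun i _ => Fin.castLE hkn i) (by simp) (by simp) ?_ (by simp)
    intro i hi
    exact ⟨⟨i, (Finset.mem_filter.mp hi).2⟩, Finset.mem_univ _, rfl⟩
  rw [hsum (fun i => g (σ i)), hsum g]
  refine Finset.sum_equiv σ (fun i => ?_) (fun _ _ => rfl)
  simp only [Finset.mem_filter, Finset.mem_univ, true_and]
  by_cases hi : (i : ℕ) < k
  · refine iff_of_true hi ?_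
    by_contra! hσi
    have := σ.injective (hσ _ hσi)
    rw [this] at hσi
    omega
  · rw [hσ i (not_lt.mp hi)]

/-- A permutation of the first `k` indices extends to all indices by the identity. -/
theorem exists_perm_extending_castLE {n k : ℕ} (hkn : k ≤ n) (τ : Equiv.Perm (Fin k)) :
    ∃ σ : Equiv.Perm (Fin n), (∀ i : Fin n, k ≤ (i : ℕ) → σ i = i) ∧
      ∀ i : Fin k, σ (Fin.castLE hkn i) = Fin.castLE hkn (τ i) := by
  refine ⟨τ.viaFintypeEmbedding (Fin.castLEEmb hkn), fun i hi => ?_, fun i =>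
    τ.viaFintypeEmbedding_apply_image (Fin.castLEEmb hkn) i⟩
  apply Equiv.Perm.viaFintypeEmbedding_apply_notMem_range
  rintro ⟨j, rfl⟩
  have := j.isLt
  simp at hi
  omega


/-- A continuous `f : [0,1]ⁿ → ℝ` is invariant under all permutations of its first `k`
coordinates iff `f x = ρ (∑_{i<k} γ(x i), x_{k+1}, …, x_n)` for some continuous `ρ`,
where `γ t = (1, t, …, tⁿ)`. -/
theorem statement1 (n k : ℕ) (hk1 : 1 ≤ k) (hkn : k ≤ n) (f : (Fin n → ℝ) → ℝ)
    (hf : ContinuousOn f (Set.Icc (0 : Fin n → ℝ) 1)) :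
    (∀ σ : Equiv.Perm (Fin n), (∀ i : Fin n, k ≤ (i : ℕ) → σ i = i) →
        ∀ x ∈ Set.Icc (0 : Fin n → ℝ) 1, f (fun i => x (σ⁻¹ i)) = f x) ↔
      ∃ ρ : (Fin (n + 1) → ℝ) × (Fin (n - k) → ℝ) → ℝ, Continuous ρ ∧
        ∀ x ∈ Set.Icc (0 : Fin n → ℝ) 1,
          f x = ρ (∑ i : Fin k, fun j : Fin (n + 1) =>
              x ⟨i, lt_of_lt_of_le i.isLt hkn⟩ ^ (j : ℕ),
            fun j : Fin (n - k) => x ⟨k + j, by have := j.isLt; omega⟩) := by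
  constructor
  · intro hinv
    refine exists_continuous_factor_of_isCompact (g := fun x : Fin n → ℝ =>
      ((∑ i : Fin k, fun j : Fin (n + 1) => x ⟨i, lt_of_lt_of_le i.isLt hkn⟩ ^ (j : ℕ),
        fun j : Fin (n - k) => x ⟨k + j, by have := j.isLt; omega⟩) :
        (Fin (n + 1) → ℝ) × (Fin (n - k) → ℝ))) isCompact_Icc hf
      (Continuous.continuousOn (by fun_prop)) fun x hx y hy hxy => ?_
    obtain ⟨hsum, htail⟩ := Prod.ext_iff.mp hxy
    obtain ⟨τ, hτ⟩ := exists_perm_of_sum_pow_eq (a := fun i : Fin k => x (Fin.castLE hkn i))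
      (b := fun i : Fin k => y (Fin.castLE hkn i)) fun j hj => by
        rw [Fintype.card_fin] at hj
        simpa [Fin.castLE] using congrFun hsum ⟨j, by omega⟩
    obtain ⟨σ, hσ_fix, hσ⟩ := exists_perm_extending_castLE hkn τ
    have hyx (i : Fin n) : y (σ i) = x i := by
      by_cases hi : (i : ℕ) < k
      · have := hσ ⟨i, hi⟩
        exact (congrArg y this).trans (hτ ⟨i, hi⟩)
      · rw [hσ_fix i (not_lt.mp hi)]
        have := congrFun htail ⟨i - k, by omega⟩
        simpa [Nat.add_sub_cancel' (not_lt.mp hi)] using this.symm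
    rw [← hinv σ hσ_fix x hx]
    congr 1
    funext i
    simp [← hyx]
  · rintro ⟨ρ, -, hρ⟩ σ hσ x hx
    have hσ' (i : Fin n) (hi : k ≤ (i : ℕ)) : σ⁻¹ i = i := by
      rw [Equiv.Perm.inv_eq_iff_eq, hσ i hi]
    rw [hρ x hx]
    refine (hρ (fun i => x (σ⁻¹ i)) ⟨fun i => hx.1 (σ⁻¹ i), fun i => hx.2 (σ⁻¹ i)⟩).trans ?_
    congr 2
    · exact sum_castLE_perm hkn hσ' fun i (j : Fin (n + 1)) => x i ^ (j : ℕ)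
    · funext j
      rw [hσ' _ (Nat.le_add_right k j)]
end

section
/- Let n ≥ 1, 1 ≤ k ≤ n, γ(t) = (1, t, …, tⁿ) ∈ ℝ^{n+1}, and let X^{(n:k)} = {x ∈ [0,1]ⁿ : x_1 ≤ x_2 ≤ … ≤ x_k} (no order constraint on the last n−k coordinates). Then the map E : X^{(n:k)} → ℝ^{n+1} × ℝ^{n-k}, E(x) = (∑_{i=1}^{k} γ(x_i), x_{k+1}, …, x_n), is injective and a homeomorphism from X^{(n:k)} onto its image E(X^{(n:k)}). -/
/-- The map `E x = (∑_{i<k} γ(x i), x_{k+1}, …, x_n)` with `γ t = (1, t, …, tⁿ)`. -/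
noncomputable def mapE (n k : ℕ) (hkn : k ≤ n) (x : Fin n → ℝ) :
    (Fin (n + 1) → ℝ) × (Fin (n - k) → ℝ) :=
  (∑ i : Fin k, fun j : Fin (n + 1) => x ⟨i, lt_of_lt_of_le i.isLt hkn⟩ ^ (j : ℕ),
   fun j : Fin (n - k) => x ⟨k + j, by have := j.isLt; omega⟩)

open MvPolynomial Finset in
/-- In characteristic zero, the first `m` power sums determine the first `m` elementary symmetric
functions. -/
theorem Multiset.esymm_eq_of_sum_pow_eq {σ K : Type*} [Fintype σ] [Field K] [CharZero K]
    {f g : σ → K} {m : ℕ} (h : ∀ j ≤ m, ∑ i, f i ^ j = ∑ i, g i ^ j) (j : ℕ) (hj : j ≤ m) :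
    (univ.val.map f).esymm j = (univ.val.map g).esymm j := by
  simp only [← aeval_esymm_eq_multiset_esymm σ K]
  induction j using Nat.strong_induction_on with
  | _ j ih =>
    rcases Nat.eq_zero_or_pos j with rfl | hpos
    · simp
    have newton (u : σ → K) := congrArg (aeval u) (mul_esymm_eq_sum σ K j)
    simp only [map_mul, map_natCast, map_pow, map_neg, map_one, map_sum, psum, aeval_X] at newton
    have hj0 : (j : K) ≠ 0 := Nat.cast_ne_zero.mpr hpos.ne'
    apply mul_left_cancel₀ hj0
    rw [newton f, newton g]
    congr 1
    refine sum_congr rfl fun a ha => ?_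
    rw [Finset.mem_filter, HasAntidiagonal.mem_antidiagonal] at ha
    rw [ih a.1 ha.2 (by lia), h a.2 (by lia)]

/-- A multiset in an integral domain is determined by its cardinality and its elementary symmetric
functions. -/
theorem Multiset.eq_of_esymm_eq {R : Type*} [CommRing R] [IsDomain R] {s t : Multiset R}
    (hcard : s.card = t.card) (h : ∀ j ≤ s.card, s.esymm j = t.esymm j) : s = t := by
  rw [← Polynomial.roots_multiset_prod_X_sub_C s, ← Polynomial.roots_multiset_prod_X_sub_C t,
    Multiset.prod_X_sub_X_eq_sum_esymm, Multiset.prod_X_sub_X_eq_sum_esymm, ← hcard]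
  congr 1
  refine Finset.sum_congr rfl fun j hj => ?_
  rw [h j (Nat.lt_succ_iff.mp (Finset.mem_range.mp hj))]

/-- Monotone tuples of length `k` in an ordered field with equal power sums up to degree `k` are
equal. -/
theorem Monotone.eq_of_sum_pow_eq {K : Type*} [Field K] [LinearOrder K] [IsStrictOrderedRing K]
    {k : ℕ} {f g : Fin k → K} (hf : Monotone f) (hg : Monotone g)
    (h : ∀ j ≤ k, ∑ i, f i ^ j = ∑ i, g i ^ j) : f = g := by
  have hms : Finset.univ.val.map f = Finset.univ.val.map g :=
    Multiset.eq_of_esymm_eq (by simp) fun j hj =>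
      Multiset.esymm_eq_of_sum_pow_eq h j (by simpa using hj)
  rw [Fin.univ_val_map, Fin.univ_val_map, Multiset.coe_eq_coe] at hms
  exact List.ofFn_injective (hms.eq_of_sortedLE hf.sortedLE_ofFn hg.sortedLE_ofFn)

theorem continuous_mapE (n k : ℕ) (hkn : k ≤ n) : Continuous (mapE n k hkn) := by
  unfold mapE
  fun_prop

theorem mapE_injOn (n k : ℕ) (hkn : k ≤ n) :
    Set.InjOn (mapE n k hkn) {x | ∀ i j : Fin n, (j : ℕ) < k → i ≤ j → x i ≤ x j} := by
  intro x hx y hy hxy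
  have hfst := congrArg Prod.fst hxy
  have hsnd := congrArg Prod.snd hxy
  have mono {z : Fin n → ℝ} (hz : ∀ i j : Fin n, (j : ℕ) < k → i ≤ j → z i ≤ z j) :
      Monotone fun i : Fin k => z ⟨i, i.isLt.trans_le hkn⟩ :=
    fun i j hij => hz _ _ j.isLt hij
  have head := (mono hx).eq_of_sum_pow_eq (mono hy) fun j hj => by
    simpa [mapE] using congrFun hfst ⟨j, by lia⟩
  funext i
  rcases lt_or_ge (i : ℕ) k with hi | hi
  · exact congrFun head ⟨i, hi⟩
  · simpa [mapE, Nat.add_sub_cancel' hi] using congrFun hsnd ⟨i - k, by lia⟩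

theorem isCompact_partially_ordered_cube (n k : ℕ) :
    IsCompact {x : Fin n → ℝ | x ∈ Set.Icc (0 : Fin n → ℝ) 1 ∧
      ∀ i j : Fin n, (j : ℕ) < k → i ≤ j → x i ≤ x j} := by
  refine isCompact_Icc.inter_right (t := {x : Fin n → ℝ | ∀ i j : Fin n, (j : ℕ) < k → i ≤ j → x i ≤ x j}) ?_
  simp only [Set.ofPred_forall]
  exact isClosed_iInter fun i => isClosed_iInter fun j => isClosed_iInter fun _ =>
    isClosed_iInter fun _ => isClosed_le (continuous_apply i) (continuous_apply j)

/-- On `X^{(n:k)} = {x ∈ [0,1]ⁿ : x_1 ≤ … ≤ x_k}`, the map `E` is injective and a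
homeomorphism onto its image (i.e. a topological embedding). -/
theorem statement3 (n k : ℕ) (hk1 : 1 ≤ k) (hkn : k ≤ n) :
    Function.Injective
        (fun x : {x : Fin n → ℝ // x ∈ Set.Icc (0 : Fin n → ℝ) 1 ∧
            ∀ i j : Fin n, (j : ℕ) < k → i ≤ j → x i ≤ x j} => mapE n k hkn x.1) ∧
      Topology.IsEmbedding
        (fun x : {x : Fin n → ℝ // x ∈ Set.Icc (0 : Fin n → ℝ) 1 ∧
            ∀ i j : Fin n, (j : ℕ) < k → i ≤ j → x i ≤ x j} => mapE n k hkn x.1) := by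
  have hinj : Function.Injective
      (fun x : {x : Fin n → ℝ // x ∈ Set.Icc (0 : Fin n → ℝ) 1 ∧
          ∀ i j : Fin n, (j : ℕ) < k → i ≤ j → x i ≤ x j} => mapE n k hkn x.1) :=
    fun x y hxy => Subtype.ext (mapE_injOn n k hkn x.2.2 y.2.2 hxy)
  have : CompactSpace {x : Fin n → ℝ // x ∈ Set.Icc (0 : Fin n → ℝ) 1 ∧
      ∀ i j : Fin n, (j : ℕ) < k → i ≤ j → x i ≤ x j} :=
    isCompact_iff_compactSpace.mp (isCompact_partially_ordered_cube n k)
  exact ⟨hinj, (((continuous_mapE n k hkn).comp continuous_subtype_val).isClosedEmbedding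
    hinj).isEmbedding⟩
end

section
/- Let k, n ≥ 1 with k dividing n, and let M, L be as follows: (Mx)_j = x_{((j−1) mod k)+1} and (I − L)x = (0,…,0, x_{k+1},…,x_n). A function ψ : ℝⁿ → ℝ is invariant under the dihedral action on its first k coordinates (invariant under all cyclic shifts h_u of the first k coordinates and under the reversal r_k^{(0)} of the first k coordinates) if and only if there exists a function φ : ℝⁿ × ℝⁿ → ℝ invariant in its first argument under the dihedral group D_{2n} acting on ℝⁿ (generated by the cyclic shift σ_n^1 and the reversal r_n), such that ψ(x) = φ(Mx, (I − L)x) for all x ∈ ℝⁿ. -/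
/-- Cyclic shift of the `m` coordinates by `u ∈ ℤ`: `(σₘᵘ v) j = v ((j − u) mod m)`. -/
def cshift (m : ℕ) (u : ℤ) (v : Fin m → ℝ) (j : Fin m) : ℝ :=
  v ⟨((((j : ℕ) : ℤ) - u) % (m : ℤ)).toNat, by
    have h0 : (0 : ℤ) < (m : ℤ) := by exact_mod_cast j.pos
    have h1 : 0 ≤ (((j : ℕ) : ℤ) - u) % (m : ℤ) := Int.emod_nonneg _ h0.ne'
    have h2 : (((j : ℕ) : ℤ) - u) % (m : ℤ) < (m : ℤ) := Int.emod_lt_of_pos _ h0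
    omega⟩

/-- Reversal of all `m` coordinates: `(rₘ v) j = v (m + 1 − j)` (1-based). -/
def revAll (m : ℕ) (v : Fin m → ℝ) (j : Fin m) : ℝ :=
  v ⟨m - 1 - (j : ℕ), by have := j.isLt; omega⟩

/-- `M : ℝⁿ → ℝⁿ`, `(M x) j = x (j mod k)`: the first `k` coordinates repeated. -/
def repMap (n k : ℕ) (hk : 0 < k) (hkn : k ≤ n) (x : Fin n → ℝ) (j : Fin n) : ℝ :=
  x ⟨(j : ℕ) % k, lt_of_lt_of_le (Nat.mod_lt _ hk) hkn⟩

/-- `h_u : ℝⁿ → ℝⁿ` cyclically shifts the first `k` coordinates by `u` and fixes the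
coordinates `k+1, …, n`. -/
def hshift (n k : ℕ) (hkn : k ≤ n) (u : ℤ) (x : Fin n → ℝ) (i : Fin n) : ℝ :=
  if h : (i : ℕ) < k then
    x ⟨((((i : ℕ) : ℤ) - u) % (k : ℤ)).toNat, by
      have h0 : (0 : ℤ) < (k : ℤ) := by exact_mod_cast Nat.pos_of_ne_zero (by omega)
      have h1 : 0 ≤ (((i : ℕ) : ℤ) - u) % (k : ℤ) := Int.emod_nonneg _ h0.ne'
      have h2 : (((i : ℕ) : ℤ) - u) % (k : ℤ) < (k : ℤ) := Int.emod_lt_of_pos _ h0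
      omega⟩
  else x i

/-- Reversal of the first `k` coordinates, fixing the rest. -/
def revFirst (n k : ℕ) (hkn : k ≤ n) (x : Fin n → ℝ) (i : Fin n) : ℝ :=
  if h : (i : ℕ) < k then x ⟨k - 1 - (i : ℕ), by omega⟩ else x i

theorem sub_emod_toNat_mod {n k : ℕ} (hk : 0 < k) (hn : 0 < n) (hdvd : k ∣ n) (j : ℕ) (u : ℤ) :
    (((j : ℤ) - u) % (n : ℤ)).toNat % k = ((((j % k : ℕ) : ℤ) - u) % (k : ℤ)).toNat := by
  have hk0 : (k : ℤ) ≠ 0 := by exact_mod_cast hk.ne'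
  have hn0 : (n : ℤ) ≠ 0 := by exact_mod_cast hn.ne'
  zify
  rw [Int.toNat_of_nonneg (Int.emod_nonneg _ hn0), Int.toNat_of_nonneg (Int.emod_nonneg _ hk0),
    Int.emod_emod_of_dvd _ (by exact_mod_cast hdvd), Int.emod_sub_emod]

theorem sub_one_sub_mod {n k j : ℕ} (hdvd : k ∣ n) (hj : j < n) :
    (n - 1 - j) % k = k - 1 - j % k := by
  obtain ⟨c, rfl⟩ := hdvd
  have hk : 0 < k := Nat.pos_of_mul_pos_right (by omega : 0 < k * c)
  have hr := Nat.mod_lt j hk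
  have hq : j / k < c := Nat.div_lt_of_lt_mul hj
  have hj' := Nat.div_add_mod j k
  obtain ⟨d, hd⟩ : ∃ d, c = j / k + 1 + d := ⟨c - (j / k + 1), by omega⟩
  have hmul : k * c = k * (j / k) + k + k * d := by
    conv_lhs => rw [hd]
    ring
  have h : k * c - 1 - j = (k - 1 - j % k) + k * d := by omega
  rw [h, Nat.add_mul_mod_self_left, Nat.mod_eq_of_lt (by omega)]

theorem cshift_repMap {n k : ℕ} (hk : 0 < k) (hn : 0 < n) (hdvd : k ∣ n) (hkn : k ≤ n)
    (u : ℤ) (x : Fin n → ℝ) :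
    cshift n u (repMap n k hk hkn x) = repMap n k hk hkn (hshift n k hkn u x) := by
  funext j
  simp only [cshift, repMap, hshift, Nat.mod_lt _ hk, dite_true]
  exact congrArg x (Fin.ext (sub_emod_toNat_mod hk hn hdvd j u))

theorem revAll_repMap {n k : ℕ} (hk : 0 < k) (hdvd : k ∣ n) (hkn : k ≤ n) (x : Fin n → ℝ) :
    revAll n (repMap n k hk hkn x) = repMap n k hk hkn (revFirst n k hkn x) := by
  funext j
  simp only [revAll, repMap, revFirst, Nat.mod_lt _ hk, dite_true]
  exact congrArg x (Fin.ext (sub_one_sub_mod hdvd j.isLt))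

theorem cshift_neg_cshift (n : ℕ) (u : ℤ) (y : Fin n → ℝ) :
    cshift n (-u) (cshift n u y) = y := by
  funext j
  have hn0 : (n : ℤ) ≠ 0 := by exact_mod_cast j.pos.ne'
  refine congrArg y (Fin.ext ?_)
  zify
  rw [Int.toNat_of_nonneg (Int.emod_nonneg _ hn0), Int.toNat_of_nonneg (Int.emod_nonneg _ hn0),
    Int.emod_sub_emod, sub_neg_eq_add, add_sub_cancel_right]
  exact Int.emod_eq_of_lt (by positivity) (by exact_mod_cast j.isLt)

theorem revAll_revAll (n : ℕ) (y : Fin n → ℝ) : revAll n (revAll n y) = y := by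
  funext j
  exact congrArg y (Fin.ext (by dsimp only; omega))

/-- The vector with the first `k` coordinates of `y` and the remaining ones of `z`. -/
def splice {n : ℕ} (k : ℕ) (y z : Fin n → ℝ) (i : Fin n) : ℝ :=
  if (i : ℕ) < k then y i else z i

theorem splice_repMap {n k : ℕ} (hk : 0 < k) (hkn : k ≤ n) (x z : Fin n → ℝ) :
    splice k (repMap n k hk hkn x) z = splice k x z := by
  funext i
  by_cases h : (i : ℕ) < k <;> simp [splice, repMap, h, Nat.mod_eq_of_lt]

theorem splice_hshift {n k : ℕ} (hkn : k ≤ n) (u : ℤ) (x z : Fin n → ℝ) :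
    splice k (hshift n k hkn u x) z = hshift n k hkn u (splice k x z) := by
  funext i
  by_cases h : (i : ℕ) < k
  · have hk0 : (0 : ℤ) < k := by exact_mod_cast Nat.zero_lt_of_lt h
    have h1 := Int.emod_nonneg ((i : ℤ) - u) hk0.ne'
    have h2 := Int.emod_lt_of_pos ((i : ℤ) - u) hk0
    have h3 : (((i : ℤ) - u) % (k : ℤ)).toNat < k := by omega
    simp only [splice, hshift, h, h3, dite_true, if_true]
  · simp [splice, hshift, h]

theorem splice_revFirst {n k : ℕ} (hkn : k ≤ n) (x z : Fin n → ℝ) :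
    splice k (revFirst n k hkn x) z = revFirst n k hkn (splice k x z) := by
  funext i
  by_cases h : (i : ℕ) < k
  · have h1 : k - 1 - (i : ℕ) < k := by omega
    simp only [splice, revFirst, h, h1, dite_true, if_true]
  · simp [splice, revFirst, h]

open Classical in
/-- Extends a function of the first `k` coordinates of `y` and the last `n - k` of `z` by zero
outside the range of `repMap`. -/
noncomputable def repExtend {n k : ℕ} (hk : 0 < k) (hkn : k ≤ n) (ψ : (Fin n → ℝ) → ℝ)
    (p : (Fin n → ℝ) × (Fin n → ℝ)) : ℝ :=
  if p.1 ∈ Set.range (repMap n k hk hkn) then ψ (splice k p.1 p.2) else 0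

theorem repExtend_repMap {n k : ℕ} (hk : 0 < k) (hkn : k ≤ n) (ψ : (Fin n → ℝ) → ℝ)
    (x z : Fin n → ℝ) :
    repExtend hk hkn ψ (repMap n k hk hkn x, z) = ψ (splice k x z) := by
  rw [repExtend, if_pos ⟨x, rfl⟩, splice_repMap]

/-- If `f` acts on the range of `repMap` through `g`, and `f` has a left inverse preserving that
range, then invariance of `ψ` under `g` gives invariance of `repExtend` under `f`. -/
theorem repExtend_invariant {n k : ℕ} (hk : 0 < k) (hkn : k ≤ n) {ψ : (Fin n → ℝ) → ℝ}
    {f f' g g' : (Fin n → ℝ) → Fin n → ℝ}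
    (hf : ∀ x, f (repMap n k hk hkn x) = repMap n k hk hkn (g x))
    (hf' : ∀ x, f' (repMap n k hk hkn x) = repMap n k hk hkn (g' x))
    (hinv : ∀ y, f' (f y) = y) (hg : ∀ x z, splice k (g x) z = g (splice k x z))
    (hψ : ∀ x, ψ (g x) = ψ x) (y z : Fin n → ℝ) :
    repExtend hk hkn ψ (f y, z) = repExtend hk hkn ψ (y, z) := by
  by_cases hy : y ∈ Set.range (repMap n k hk hkn)
  · obtain ⟨x, rfl⟩ := hy
    rw [hf, repExtend_repMap, repExtend_repMap, hg, hψ]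
  · have hfy : f y ∉ Set.range (repMap n k hk hkn) := by
      rintro ⟨x, hx⟩
      exact hy ⟨g' x, by rw [← hf', hx, hinv]⟩
    rw [repExtend, repExtend, if_neg hy, if_neg hfy]

/-- If `k ∣ n`, a function `ψ : ℝⁿ → ℝ` is invariant under the dihedral action on its
first `k` coordinates (all cyclic shifts `h_u` and the reversal `r_k⁰`) iff
`ψ x = φ (M x, (I − L) x)` for some `φ` whose first argument is invariant under the
dihedral group `D_{2n}` (generated by the cyclic shifts and the reversal `rₙ`). -/
theorem statement15 (n k : ℕ) (hk : 1 ≤ k) (hn : 1 ≤ n) (hdvd : k ∣ n)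
    (ψ : (Fin n → ℝ) → ℝ) :
    ((∀ (u : ℤ) (x : Fin n → ℝ), ψ (hshift n k (Nat.le_of_dvd hn hdvd) u x) = ψ x) ∧
      ∀ x : Fin n → ℝ, ψ (revFirst n k (Nat.le_of_dvd hn hdvd) x) = ψ x) ↔
      ∃ φ : (Fin n → ℝ) × (Fin n → ℝ) → ℝ,
        ((∀ (u : ℤ) (y z : Fin n → ℝ), φ (cshift n u y, z) = φ (y, z)) ∧
          ∀ y z : Fin n → ℝ, φ (revAll n y, z) = φ (y, z)) ∧
        ∀ x : Fin n → ℝ,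
          ψ x = φ (repMap n k hk (Nat.le_of_dvd hn hdvd) x,
            fun i : Fin n => if (i : ℕ) < k then 0 else x i) := by
  have hkn := Nat.le_of_dvd hn hdvd
  constructor
  · rintro ⟨hshift_inv, hrev_inv⟩
    refine ⟨repExtend hk hkn ψ, ⟨fun u => ?_, ?_⟩, fun x => ?_⟩
    · exact repExtend_invariant hk hkn (cshift_repMap hk hn hdvd hkn u)
        (cshift_repMap hk hn hdvd hkn (-u)) (cshift_neg_cshift n u)
        (splice_hshift hkn u) (hshift_inv u)
    · exact repExtend_invariant hk hkn (revAll_repMap hk hdvd hkn)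
        (revAll_repMap hk hdvd hkn) (revAll_revAll n) (splice_revFirst hkn) hrev_inv
    · rw [repExtend_repMap]
      congr 1
      funext i
      by_cases h : (i : ℕ) < k <;> simp [splice, h]
  · rintro ⟨φ, ⟨hφshift, hφrev⟩, hψ⟩
    refine ⟨fun u x => ?_, fun x => ?_⟩
    · rw [hψ, hψ x, ← cshift_repMap hk hn hdvd hkn, hφshift]
      congr 2
      funext i
      by_cases h : (i : ℕ) < k <;> simp [hshift, h]
    · rw [hψ, hψ x, ← revAll_repMap hk hdvd hkn, hφrev]
      congr 2
      funext i
      by_cases h : (i : ℕ) < k <;> simp [revFirst, h]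
end
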